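/- arXiv:1505.04927 — 2 statements merged into one kernel-verified Lean document; each statement's English description precedes it below -/
import Mathlib

section
/- For every ν ∈ (0,1) and δ̂ ∈ ℝ, the series defining Ψ̂^{ν}_{δ̂}(t) and Ψ̂^{ν,c}_{δ̂}(t) converge absolutely for every t ∈ [0,∞), the functions t ↦ Ψ̂^{ν}_{δ̂}(t) and t ↦ Ψ̂^{ν,c}_{δ̂}(t) are continuous on [0,∞), and both functions are strictly positive: Ψ̂^{ν}_{δ̂}(t) > 0 and Ψ̂^{ν,c}_{δ̂}(t) > 0 for all t ≥ 0. -/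
open MeasureTheory
open scoped ENNReal

/-- Product of `w` over the successive gaps of a list, starting from `prev`. -/
noncomputable def gapProd (w : ℕ → ℝ) : ℕ → List ℕ → ℝ
  | _, [] => 1
  | prev, n :: rest => w (n - prev) * gapProd w n rest

/-- Discrete constrained partition function
`Ψ^c_δ(N) = 1 + Σ_{k=1}^{N-1} (e^δ-1)^k Σ_{0<n₁<⋯<n_k<N} (∏ w(nᵢ-nᵢ₋₁)) w(N-n_k)/w(N)`,
with `Ψ^c_δ(0) = Ψ^c_δ(1) = 1`. -/
noncomputable def PsiCons (w : ℕ → ℝ) (δ : ℝ) (N : ℕ) : ℝ :=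
  1 + ∑ k ∈ Finset.Icc 1 (N - 1), (Real.exp δ - 1) ^ k *
      ∑ s ∈ (Finset.Ioo 0 N).powersetCard k,
        gapProd w 0 (s.sort (· ≤ ·) ++ [N]) / w N

/-- Discrete free partition function
`Ψ_δ(N) = 1 + Σ_{k=1}^{N} (e^δ-1)^k Σ_{0<n₁<⋯<n_k≤N} ∏ w(nᵢ-nᵢ₋₁)`, with `Ψ_δ(0) = 1`. -/
noncomputable def PsiFree (w : ℕ → ℝ) (δ : ℝ) (N : ℕ) : ℝ :=
  1 + ∑ k ∈ Finset.Icc 1 N, (Real.exp δ - 1) ^ k *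
      ∑ s ∈ (Finset.Icc 1 N).powersetCard k,
        gapProd w 0 (s.sort (· ≤ ·))

/-- Linear interpolation of `F : ℕ → ℝ` between consecutive integers. -/
noncomputable def interp (F : ℕ → ℝ) (x : ℝ) : ℝ :=
  F ⌊x⌋₊ + (x - ⌊x⌋₊) * (F (⌊x⌋₊ + 1) - F ⌊x⌋₊)

/-- The gap `vᵢ - vᵢ₋₁` (with `v₋₁ := 0`) of a vector `v : Fin k → ℝ`. -/
noncomputable def gapR {k : ℕ} (v : Fin k → ℝ) (i : Fin k) : ℝ :=
  v i - (if _h : (i : ℕ) = 0 then 0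
    else v ⟨(i : ℕ) - 1, lt_of_le_of_lt (Nat.sub_le _ _) i.isLt⟩)

/-- The `(k+1)`-fold simplex integral
`∫_{0<t₁<⋯<t_{k+1}<t} ∏ᵢ (tᵢ-tᵢ₋₁)^{-(1-ν)} dt₁⋯dt_{k+1}` (as a Lebesgue integral). -/
noncomputable def simplexIntLFree (ν t : ℝ) (k : ℕ) : ℝ≥0∞ :=
  ∫⁻ v : Fin (k + 1) → ℝ,
    Set.indicator {v : Fin (k + 1) → ℝ | StrictMono v ∧ 0 < v 0 ∧ v (Fin.last k) < t}
      (fun v => ENNReal.ofReal (∏ i, gapR v i ^ (-(1 - ν)))) v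

noncomputable def simplexIntFree (ν t : ℝ) (k : ℕ) : ℝ :=
  (simplexIntLFree ν t k).toReal

/-- The `(k+1)`-fold simplex integral
`∫_{0<t₁<⋯<t_{k+1}<t} t^{1-ν} (t-t_{k+1})^{-(1-ν)} ∏ᵢ (tᵢ-tᵢ₋₁)^{-(1-ν)} dt₁⋯dt_{k+1}`. -/
noncomputable def simplexIntLCons (ν t : ℝ) (k : ℕ) : ℝ≥0∞ :=
  ∫⁻ v : Fin (k + 1) → ℝ,
    Set.indicator {v : Fin (k + 1) → ℝ | StrictMono v ∧ 0 < v 0 ∧ v (Fin.last k) < t}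
      (fun v => ENNReal.ofReal (t ^ (1 - ν) * (t - v (Fin.last k)) ^ (-(1 - ν)) *
        ∏ i, gapR v i ^ (-(1 - ν)))) v

noncomputable def simplexIntCons (ν t : ℝ) (k : ℕ) : ℝ :=
  (simplexIntLCons ν t k).toReal

/-- Continuum free function `Ψ̂^ν_δ̂(t) = 1 + Σ_{k≥1} δ̂^k ∫_{0<t₁<⋯<t_k<t} ∏ (tᵢ-tᵢ₋₁)^{-(1-ν)}`. -/
noncomputable def PsiHatFree (ν d t : ℝ) : ℝ :=
  1 + ∑' k : ℕ, d ^ (k + 1) * simplexIntFree ν t k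

/-- Continuum constrained function `Ψ̂^{ν,c}_δ̂(t)`. -/
noncomputable def PsiHatCons (ν d t : ℝ) : ℝ :=
  1 + ∑' k : ℕ, d ^ (k + 1) * simplexIntCons ν t k

open Set Filter Topology
/-- The scaled beta integral as a Lebesgue integral. -/
theorem lintegral_rpow_mul_sub_rpow {a b s : ℝ} (ha : 0 < a) (hb : 0 < b) (hs : 0 < s) :
    ∫⁻ u in Ioo 0 s, ENNReal.ofReal (u ^ (a - 1) * (s - u) ^ (b - 1)) =
      ENNReal.ofReal (ProbabilityTheory.beta a b * s ^ (a + b - 1)) := by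
  have hB := ProbabilityTheory.beta_pos ha hb
  have h1 := ProbabilityTheory.lintegral_betaPDF_eq_one ha hb
  rw [← Real.smul_map_volume_mul_left (a := s⁻¹) (by positivity), lintegral_smul_measure,
    lintegral_map (by unfold ProbabilityTheory.betaPDF; fun_prop) (by fun_prop)] at h1
  rw [← lintegral_indicator measurableSet_Ioo]
  have key : ∀ u : ℝ, (Ioo 0 s).indicator
      (fun u ↦ ENNReal.ofReal (u ^ (a - 1) * (s - u) ^ (b - 1))) u =
      ENNReal.ofReal (ProbabilityTheory.beta a b * s ^ (a + b - 2)) *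
        ProbabilityTheory.betaPDF a b (s⁻¹ * u) := by
    intro u
    by_cases hu : u ∈ Ioo 0 s
    · have hu1 : s⁻¹ * u < 1 := by rw [inv_mul_lt_one₀ hs]; exact hu.2
      have hu0 : 0 < s⁻¹ * u := mul_pos (inv_pos.2 hs) hu.1
      rw [indicator_of_mem hu, ProbabilityTheory.betaPDF_of_pos_lt_one hu0 hu1,
        ← ENNReal.ofReal_mul (by positivity)]
      congr 1
      obtain ⟨w, rfl⟩ : ∃ w, u = s * w := ⟨s⁻¹ * u, by field_simp⟩
      rw [inv_mul_cancel_left₀ hs.ne'] at hu0 hu1 ⊢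
      rw [show s - s * w = s * (1 - w) by ring, Real.mul_rpow hs.le hu0.le,
        Real.mul_rpow hs.le (by linarith),
        show s ^ (a + b - 2) = s ^ (a - 1) * s ^ (b - 1) by rw [← Real.rpow_add hs]; ring_nf]
      field_simp
    · rw [indicator_of_notMem hu]
      rcases le_or_gt u 0 with h | h
      · rw [ProbabilityTheory.betaPDF_eq_zero_of_nonpos, mul_zero]
        exact mul_nonpos_of_nonneg_of_nonpos (by positivity) h
      · rw [ProbabilityTheory.betaPDF_eq_zero_of_one_le, mul_zero]
        rw [one_le_inv_mul₀ hs]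
        exact not_lt.1 fun h' ↦ hu ⟨h, h'⟩
  simp_rw [key]
  rw [lintegral_const_mul _ (by unfold ProbabilityTheory.betaPDF; fun_prop)]
  rw [abs_of_pos (by positivity)] at h1
  have h2 : ∫⁻ u, ProbabilityTheory.betaPDF a b (s⁻¹ * u) = ENNReal.ofReal s := by
    rw [smul_eq_mul, ENNReal.ofReal_inv_of_pos hs] at h1
    rw [← inv_inv (ENNReal.ofReal s)]
    exact ENNReal.eq_inv_of_mul_eq_one_left (by rwa [mul_comm])
  rw [h2, ← ENNReal.ofReal_mul (by positivity), mul_assoc]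
  congr 2
  rw [← Real.rpow_add_one hs.ne']; ring_nf

/-- A nonnegative function whose Lebesgue integral is `ofReal c` is integrable with integral `c`. -/
theorem hasIntegral_of_lintegral_ofReal_eq {α : Type*} [MeasurableSpace α] {μ : Measure α}
    {f : α → ℝ} {c : ℝ} (hf : AEStronglyMeasurable f μ) (h0 : 0 ≤ᵐ[μ] f) (hc : 0 ≤ c)
    (h : ∫⁻ x, ENNReal.ofReal (f x) ∂μ = ENNReal.ofReal c) :
    Integrable f μ ∧ ∫ x, f x ∂μ = c := by
  refine ⟨(lintegral_ofReal_ne_top_iff_integrable hf h0).1 (h ▸ ENNReal.ofReal_ne_top), ?_⟩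
  rw [integral_eq_lintegral_of_nonneg_ae h0 hf, h, ENNReal.toReal_ofReal hc]

theorem summable_pow_div_Gamma {ν b : ℝ} (hν : ν ∈ Ioo (0 : ℝ) 1) (hb : 0 < b) (x : ℝ) :
    Summable fun k : ℕ ↦ x ^ k / Real.Gamma (k * ν + b) := by
  obtain ⟨hν0, hν1⟩ := hν
  rcases eq_or_ne x 0 with rfl | hx
  · exact summable_of_ne_finset_zero (s := {0}) fun k hk ↦ by
      simp [show k ≠ 0 by simpa using hk]
  have hG : ∀ y : ℝ, 0 < y → Real.Gamma y / Real.Gamma (y + ν) ≤ (y + ν) ^ (1 - ν) / y := by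
    intro y hy
    have h := Real.Gamma_mul_add_mul_le_rpow_Gamma_mul_rpow_Gamma (s := y + ν) (t := y + ν + 1)
      (a := ν) (b := 1 - ν) (by linarith) (by linarith) hν0 (by linarith) (by ring)
    have hp : 0 < Real.Gamma (y + ν) := Real.Gamma_pos_of_pos (by linarith)
    rw [show ν * (y + ν) + (1 - ν) * (y + ν + 1) = y + 1 by ring,
      Real.Gamma_add_one hy.ne', Real.Gamma_add_one (by linarith),
      Real.mul_rpow (by linarith) hp.le, mul_left_comm, ← Real.rpow_add hp] at h
    rw [div_le_div_iff₀ hp hy]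
    simpa [mul_comm] using h
  have hy : Tendsto (fun k : ℕ ↦ (k : ℝ) * ν + b) atTop atTop :=
    tendsto_atTop_add_const_right _ _
      (tendsto_natCast_atTop_atTop.atTop_mul_const hν0)
  have hr : Tendsto (fun y : ℝ ↦ |x| * (2 * y ^ (-ν))) atTop (𝓝 0) := by
    simpa using ((tendsto_rpow_neg_atTop hν0).const_mul 2).const_mul |x|
  refine summable_of_ratio_test_tendsto_lt_one (l := 0) one_pos ?_ ?_
  · refine Eventually.of_forall fun k ↦ div_ne_zero (pow_ne_zero _ hx) ?_
    exact (Real.Gamma_pos_of_pos (by positivity)).ne'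
  · refine squeeze_zero' (Eventually.of_forall fun k ↦ by positivity) ?_ (hr.comp hy)
    filter_upwards [hy.eventually_ge_atTop 1] with k hk
    set y := (k : ℝ) * ν + b
    have hy0 : 0 < y := by linarith
    have e : ((k + 1 : ℕ) : ℝ) * ν + b = y + ν := by push_cast; simp only [y]; ring
    have g1 : 0 < Real.Gamma y := Real.Gamma_pos_of_pos hy0
    have g2 : 0 < Real.Gamma (y + ν) := Real.Gamma_pos_of_pos (by linarith)
    rw [e, Function.comp_apply, norm_div, norm_div, norm_pow, norm_pow, Real.norm_eq_abs,
      Real.norm_of_nonneg g1.le, Real.norm_of_nonneg g2.le]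
    have hx' : 0 < |x| := abs_pos.2 hx
    calc |x| ^ (k + 1) / Real.Gamma (y + ν) / (|x| ^ k / Real.Gamma y)
        = |x| * (Real.Gamma y / Real.Gamma (y + ν)) := by
          rw [pow_succ]
          field_simp
      _ ≤ |x| * ((y + ν) ^ (1 - ν) / y) := mul_le_mul_of_nonneg_left (hG y hy0) hx'.le
      _ ≤ |x| * ((2 * y) ^ (1 - ν) / y) := by
        gcongr
        linarith
      _ = |x| * (2 ^ (1 - ν) * y ^ (-ν)) := by
        rw [Real.mul_rpow (by norm_num) hy0.le, Real.rpow_sub hy0, Real.rpow_one,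
          Real.rpow_neg hy0.le]
        field_simp
      _ ≤ |x| * (2 * y ^ (-ν)) := by
        gcongr
        exact (Real.rpow_le_rpow_of_exponent_le (by norm_num) (by linarith)).trans_eq
          (Real.rpow_one 2)

@[fun_prop]
theorem measurable_gapR {k : ℕ} (i : Fin k) : Measurable fun v : Fin k → ℝ ↦ gapR v i := by
  unfold gapR
  split_ifs <;> fun_prop

theorem measurableSet_strictMono_pos (k : ℕ) :
    MeasurableSet {v : Fin (k + 1) → ℝ | StrictMono v ∧ 0 < v 0} := by
  have h : {v : Fin (k + 1) → ℝ | StrictMono v ∧ 0 < v 0} =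
      (⋂ i : Fin k, {v | v i.castSucc < v i.succ}) ∩ {v | 0 < v 0} := by
    ext v
    simp [Fin.strictMono_iff_lt_succ]
  rw [h]
  exact (MeasurableSet.iInter fun i ↦ measurableSet_lt (by fun_prop) (by fun_prop)).inter
    (measurableSet_lt (by fun_prop) (by fun_prop))

theorem gapR_snoc_castSucc {k : ℕ} (v : Fin (k + 1) → ℝ) (s : ℝ) (i : Fin (k + 1)) :
    gapR (Fin.snoc v s : Fin (k + 2) → ℝ) i.castSucc = gapR v i := by
  unfold gapR
  rw [Fin.snoc_castSucc (α := fun _ ↦ ℝ)]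
  by_cases h : (i : ℕ) = 0
  · simp [h]
  · have := Fin.snoc_castSucc (α := fun _ ↦ ℝ) s v
      ⟨(i : ℕ) - 1, lt_of_le_of_lt (Nat.sub_le _ _) i.isLt⟩
    simp only [Fin.castSucc_mk] at this
    simp [h, this]

theorem gapR_snoc_last {k : ℕ} (v : Fin (k + 1) → ℝ) (s : ℝ) :
    gapR (Fin.snoc v s : Fin (k + 2) → ℝ) (Fin.last _) = s - v (Fin.last k) := by
  unfold gapR
  have := Fin.snoc_castSucc (α := fun _ ↦ ℝ) s v (Fin.last k)
  have h2 : (Fin.last k).castSucc = (⟨k, by omega⟩ : Fin (k + 2)) := rfl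
  rw [h2] at this
  simp [this]

theorem strictMono_snoc_iff {k : ℕ} (v : Fin (k + 1) → ℝ) (s : ℝ) :
    StrictMono (Fin.snoc v s : Fin (k + 2) → ℝ) ↔ StrictMono v ∧ v (Fin.last k) < s := by
  rw [Fin.strictMono_iff_lt_succ, Fin.strictMono_iff_lt_succ, Fin.forall_fin_succ']
  have h (i : Fin k) : i.castSucc.succ = i.succ.castSucc := rfl
  have h' : (Fin.last k).succ = Fin.last (k + 1) := rfl
  simp only [h, h', Fin.snoc_castSucc (α := fun _ ↦ ℝ), Fin.snoc_last]

/-- Integrating out all points of the simplex but the last one: the last point has density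
`Γ(ν)^(k+1) / Γ((k+1)ν) * s^((k+1)ν-1)`. -/
theorem lintegral_simplex {ν : ℝ} (hν : 0 < ν) (k : ℕ) {g : ℝ → ℝ≥0∞} (hg : Measurable g) :
    ∫⁻ v : Fin (k + 1) → ℝ, {v : Fin (k + 1) → ℝ | StrictMono v ∧ 0 < v 0}.indicator
      (fun v ↦ ENNReal.ofReal (∏ i, gapR v i ^ (ν - 1)) * g (v (Fin.last k))) v =
    ∫⁻ s in Ioi 0, ENNReal.ofReal
      (Real.Gamma ν ^ (k + 1) / Real.Gamma ((k + 1) * ν) * s ^ ((k + 1) * ν - 1)) * g s := by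
  induction k generalizing g with
  | zero =>
    have hG := (Real.Gamma_pos_of_pos hν).ne'
    refine ((volume_preserving_funUnique (Fin 1) ℝ).symm.lintegral_comp_emb
      (MeasurableEquiv.measurableEmbedding _) _).symm.trans ?_
    rw [← lintegral_indicator measurableSet_Ioi]
    refine lintegral_congr fun s ↦ ?_
    by_cases hs : 0 < s
    · rw [indicator_of_mem, indicator_of_mem (mem_Ioi.2 hs)]
      · simp [gapR, MeasurableEquiv.funUnique, hG]
      · exact ⟨Subsingleton.strictMono (α := Fin 1) _, hs⟩
    · rw [indicator_of_notMem, indicator_of_notMem (by simpa using hs)]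
      exact fun h ↦ hs h.2
  | succ k ih =>
    set H : ℝ → ℝ≥0∞ := fun u ↦
      ∫⁻ s, (Ioi u).indicator (fun s ↦ ENNReal.ofReal ((s - u) ^ (ν - 1)) * g s) s with hH
    have hm : Measurable fun p : ℝ × ℝ ↦
        (Ioi p.1).indicator (fun s ↦ ENNReal.ofReal ((s - p.1) ^ (ν - 1)) * g s) p.2 := by
      have : (fun p : ℝ × ℝ ↦
          (Ioi p.1).indicator (fun s ↦ ENNReal.ofReal ((s - p.1) ^ (ν - 1)) * g s) p.2) =
          {p : ℝ × ℝ | p.1 < p.2}.indicator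
            fun p ↦ ENNReal.ofReal ((p.2 - p.1) ^ (ν - 1)) * g p.2 := rfl
      rw [this]
      exact Measurable.indicator (by fun_prop) (measurableSet_lt (by fun_prop) (by fun_prop))
    have hmu (u : ℝ) : Measurable fun s ↦
        (Ioi u).indicator (fun s ↦ ENNReal.ofReal ((s - u) ^ (ν - 1)) * g s) s :=
      hm.comp measurable_prodMk_left
    have hHm : Measurable H := hm.lintegral_prod_right'
    have hF : Measurable fun v : Fin (k + 2) → ℝ ↦
        {v : Fin (k + 2) → ℝ | StrictMono v ∧ 0 < v 0}.indicator
          (fun v ↦ ENNReal.ofReal (∏ i, gapR v i ^ (ν - 1)) * g (v (Fin.last _))) v :=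
      Measurable.indicator (by fun_prop) (measurableSet_strictMono_pos _)
    rw [← (volume_preserving_piFinSuccAbove (fun _ : Fin (k + 2) ↦ ℝ)
      (Fin.last _)).symm.lintegral_comp_emb (MeasurableEquiv.measurableEmbedding _)]
    rw [Measure.volume_eq_prod, lintegral_prod_symm]
    swap
    · exact (hF.comp (MeasurableEquiv.measurable _)).aemeasurable
    have step : ∀ v : Fin (k + 1) → ℝ, (∫⁻ s : ℝ,
        {v : Fin (k + 2) → ℝ | StrictMono v ∧ 0 < v 0}.indicator
          (fun v ↦ ENNReal.ofReal (∏ i, gapR v i ^ (ν - 1)) * g (v (Fin.last _)))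
          ((MeasurableEquiv.piFinSuccAbove (fun _ : Fin (k + 2) ↦ ℝ) (Fin.last _)).symm (s, v))) =
        {v : Fin (k + 1) → ℝ | StrictMono v ∧ 0 < v 0}.indicator
          (fun v ↦ ENNReal.ofReal (∏ i, gapR v i ^ (ν - 1)) * H (v (Fin.last k))) v := by
      intro v
      have hs : ∀ s : ℝ, (MeasurableEquiv.piFinSuccAbove (fun _ : Fin (k + 2) ↦ ℝ)
          (Fin.last _)).symm (s, v) = (Fin.snoc v s : Fin (k + 2) → ℝ) := fun s ↦
        Fin.insertNth_last' s v
      simp_rw [hs]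
      by_cases hv : StrictMono v ∧ 0 < v 0
      · rw [indicator_of_mem (show v ∈ {v : Fin (k + 1) → ℝ | StrictMono v ∧ 0 < v 0} from hv),
          hH, ← lintegral_const_mul _ (hmu _)]
        refine lintegral_congr fun s ↦ ?_
        by_cases hvs : v (Fin.last k) < s
        · rw [indicator_of_mem (mem_Ioi.2 hvs), indicator_of_mem, Fin.prod_univ_castSucc,
            gapR_snoc_last, Fin.snoc_last, ENNReal.ofReal_mul', mul_assoc]
          · simp_rw [gapR_snoc_castSucc]
          · exact Real.rpow_nonneg (by linarith) _
          · exact ⟨(strictMono_snoc_iff v s).2 ⟨hv.1, hvs⟩,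
              (Fin.snoc_apply_zero (α := fun _ ↦ ℝ) s v).symm ▸ hv.2⟩
        · rw [indicator_of_notMem (s := Ioi _) (by simpa using hvs), indicator_of_notMem, mul_zero]
          exact fun h ↦ hvs ((strictMono_snoc_iff v s).1 h.1).2
      · rw [indicator_of_notMem (show v ∉ {v : Fin (k + 1) → ℝ | StrictMono v ∧ 0 < v 0} from hv)]
        refine (lintegral_congr fun s ↦ indicator_of_notMem ?_ _).trans lintegral_zero
        refine fun h ↦ hv ⟨((strictMono_snoc_iff v s).1 h.1).1, ?_⟩
        exact (Fin.snoc_apply_zero (α := fun _ ↦ ℝ) s v) ▸ h.2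
    rw [lintegral_congr step, ih hHm]
    set C := Real.Gamma ν ^ (k + 1) / Real.Gamma ((k + 1) * ν) with hC
    have hk : 0 < (k + 1) * ν := by positivity
    have hGk := Real.Gamma_pos_of_pos hk
    have hG := Real.Gamma_pos_of_pos hν
    have hC0 : 0 < C := by positivity
    have swap : ∫⁻ u in Ioi 0, ENNReal.ofReal (C * u ^ ((k + 1) * ν - 1)) * H u =
        ∫⁻ s, ∫⁻ u in Ioi 0, ENNReal.ofReal (C * u ^ ((k + 1) * ν - 1)) *
          (Ioi u).indicator (fun s ↦ ENNReal.ofReal ((s - u) ^ (ν - 1)) * g s) s := by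
      rw [lintegral_lintegral_swap]
      · refine lintegral_congr fun u ↦ ?_
        rw [lintegral_const_mul _ (hmu _)]
      · have : Measurable fun p : ℝ × ℝ ↦ ENNReal.ofReal (C * p.1 ^ ((k + 1) * ν - 1)) := by
          fun_prop
        exact ((this.mul hm).comp measurable_swap).aemeasurable
    rw [swap, ← lintegral_indicator measurableSet_Ioi]
    refine lintegral_congr fun s ↦ ?_
    have inner : ∫⁻ u in Ioi 0, ENNReal.ofReal (C * u ^ ((k + 1) * ν - 1)) *
          (Ioi u).indicator (fun s ↦ ENNReal.ofReal ((s - u) ^ (ν - 1)) * g s) s =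
        ∫⁻ u in Ioo 0 s, ENNReal.ofReal (u ^ ((k + 1) * ν - 1) * (s - u) ^ (ν - 1)) *
          (ENNReal.ofReal C * g s) := by
      rw [← lintegral_indicator measurableSet_Ioi, ← lintegral_indicator measurableSet_Ioo]
      refine lintegral_congr fun u ↦ ?_
      by_cases hu : 0 < u
      · by_cases hus : u < s
        · rw [indicator_of_mem (mem_Ioi.2 hu), indicator_of_mem (mem_Ioi.2 hus),
            indicator_of_mem (mem_Ioo.2 ⟨hu, hus⟩), ENNReal.ofReal_mul hC0.le,
            ENNReal.ofReal_mul (by positivity)]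
          ring
        · rw [indicator_of_mem (mem_Ioi.2 hu), indicator_of_notMem (by simpa using hus), mul_zero,
            indicator_of_notMem fun h ↦ hus h.2]
      · rw [indicator_of_notMem (by simpa using hu), indicator_of_notMem fun h ↦ hu h.1]
    rw [inner]
    by_cases hs : 0 < s
    · rw [lintegral_mul_const _ (by fun_prop), lintegral_rpow_mul_sub_rpow hk hν hs,
        indicator_of_mem (mem_Ioi.2 hs), ← mul_assoc, ← ENNReal.ofReal_mul' hC0.le,
        ProbabilityTheory.beta]
      congr 2
      push_cast
      rw [show ((k : ℝ) + 1 + 1) * ν = (k + 1) * ν + ν by ring, hC, pow_succ _ (k + 1)]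
      field_simp
    · rw [Ioo_eq_empty hs, indicator_of_notMem (by simpa using hs)]
      simp

/-- Coefficients of the normalised Mittag-Leffler series. -/
noncomputable def mlCoeff (ν b : ℝ) (k : ℕ) : ℝ :=
  Real.Gamma ν ^ k * Real.Gamma b / Real.Gamma (k * ν + b)

/-- The function `Γ(b) E_{ν,b}(Γ(ν) x)`, where `E_{ν,b}` is the Mittag-Leffler function. -/
noncomputable def mlSeries (ν b x : ℝ) : ℝ := ∑' k, mlCoeff ν b k * x ^ k

theorem mlCoeff_pos {ν b : ℝ} (hν : 0 < ν) (hb : 0 < b) (k : ℕ) : 0 < mlCoeff ν b k := by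
  have h1 := Real.Gamma_pos_of_pos hν
  have h2 := Real.Gamma_pos_of_pos hb
  have h3 : 0 < Real.Gamma (k * ν + b) := Real.Gamma_pos_of_pos (by positivity)
  unfold mlCoeff
  positivity

theorem mlCoeff_zero {ν b : ℝ} (hb : 0 < b) : mlCoeff ν b 0 = 1 := by
  simp [mlCoeff, (Real.Gamma_pos_of_pos hb).ne']

theorem mlCoeff_mul_beta {ν b : ℝ} (hν : 0 < ν) (hb : 0 < b) (k : ℕ) :
    mlCoeff ν b k * ProbabilityTheory.beta (k * ν + b) ν = mlCoeff ν b (k + 1) := by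
  have h3 : 0 < Real.Gamma (k * ν + b) := Real.Gamma_pos_of_pos (by positivity)
  unfold mlCoeff ProbabilityTheory.beta
  rw [show ((k + 1 : ℕ) : ℝ) * ν + b = k * ν + b + ν by push_cast; ring, pow_succ]
  field_simp

theorem summable_mlCoeff {ν b : ℝ} (hν : ν ∈ Ioo (0 : ℝ) 1) (hb : 0 < b) (x : ℝ) :
    Summable fun k ↦ mlCoeff ν b k * x ^ k := by
  refine ((summable_pow_div_Gamma hν hb (Real.Gamma ν * x)).mul_left (Real.Gamma b)).congr
    fun k ↦ ?_
  rw [mlCoeff, mul_pow]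
  ring

theorem continuous_mlSeries {ν b : ℝ} (hν : ν ∈ Ioo (0 : ℝ) 1) (hb : 0 < b) :
    Continuous (mlSeries ν b) := by
  refine continuous_iff_continuousAt.2 fun x ↦ ?_
  have hc : ContinuousOn (mlSeries ν b) (Metric.ball 0 (|x| + 1)) := by
    refine continuousOn_tsum (u := fun k ↦ mlCoeff ν b k * (|x| + 1) ^ k)
      (fun k ↦ by fun_prop) (summable_mlCoeff hν hb _) fun k y hy ↦ ?_
    have hy' : |y| ≤ |x| + 1 := by simpa using (mem_ball_zero_iff.1 hy).le
    rw [norm_mul, norm_pow, Real.norm_of_nonneg (mlCoeff_pos hν.1 hb k).le, Real.norm_eq_abs]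
    have := (mlCoeff_pos hν.1 hb k).le
    gcongr
  exact hc.continuousAt (Metric.isOpen_ball.mem_nhds (by simp))

theorem mlSeries_eq_one_add {ν b : ℝ} (hν : ν ∈ Ioo (0 : ℝ) 1) (hb : 0 < b) (x : ℝ) :
    mlSeries ν b x = 1 + ∑' k, mlCoeff ν b (k + 1) * x ^ (k + 1) := by
  rw [mlSeries, (summable_mlCoeff hν hb x).tsum_eq_zero_add, mlCoeff_zero hb]
  simp

/-- The Volterra kernel whose iterates generate `mlSeries`. -/
noncomputable def volterraKernel (ν b t s : ℝ) : ℝ :=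
  t ^ (1 - b) * ((t - s) ^ (ν - 1) * s ^ (b - 1))

theorem volterraKernel_nonneg {ν b t s : ℝ} (hs : 0 ≤ s) (hst : s ≤ t) :
    0 ≤ volterraKernel ν b t s :=
  mul_nonneg (Real.rpow_nonneg (hs.trans hst) _)
    (mul_nonneg (Real.rpow_nonneg (sub_nonneg.2 hst) _) (Real.rpow_nonneg hs _))

theorem volterraKernel_anti {ν b s t T : ℝ} (hν : ν ≤ 1) (hb : ν ≤ b) (hs : 0 < s)
    (hst : s < t) (htT : t ≤ T) : volterraKernel ν b T s ≤ volterraKernel ν b t s := by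
  have ht : 0 < t := hs.trans hst
  have key : ∀ u : ℝ, s < u →
      volterraKernel ν b u s = u ^ (ν - b) * (u / (u - s)) ^ (1 - ν) * s ^ (b - 1) := by
    intro u hu
    have hu0 : 0 < u := hs.trans hu
    rw [volterraKernel, Real.div_rpow hu0.le (by linarith), ← neg_sub 1 ν,
      Real.rpow_neg (by linarith), div_eq_mul_inv, ← mul_assoc, ← mul_assoc,
      ← Real.rpow_add hu0]
    ring_nf
  rw [key T (hst.trans_le htT), key t hst]
  have h0 : 0 < T - s := by linarith
  have h1 : 0 < t - s := by linarith
  have h2 : T ^ (ν - b) ≤ t ^ (ν - b) :=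
    Real.rpow_le_rpow_of_nonpos ht htT (by linarith)
  have h3 : T / (T - s) ≤ t / (t - s) := by
    rw [div_le_div_iff₀ h0 h1]
    nlinarith
  have hT : 0 < T := ht.trans_le htT
  have : 0 ≤ 1 - ν := by linarith
  gcongr

theorem integral_volterraKernel_mul {ν b t : ℝ} (hν : 0 < ν) (hb : 0 < b) (ht : 0 < t) (k : ℕ) :
    IntegrableOn (fun s ↦ volterraKernel ν b t s * (mlCoeff ν b k * (s ^ ν) ^ k)) (Ioo 0 t) ∧
    ∫ s in Ioo 0 t, volterraKernel ν b t s * (mlCoeff ν b k * (s ^ ν) ^ k) =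
      mlCoeff ν b (k + 1) * (t ^ ν) ^ (k + 1) := by
  have hkb : 0 < k * ν + b := by positivity
  have h0 := hasIntegral_of_lintegral_ofReal_eq (μ := volume.restrict (Ioo 0 t))
    (f := fun u ↦ u ^ (k * ν + b - 1) * (t - u) ^ (ν - 1))
    (Measurable.aestronglyMeasurable (by fun_prop))
    (ae_restrict_of_forall_mem measurableSet_Ioo fun u hu ↦
      mul_nonneg (Real.rpow_nonneg hu.1.le _) (Real.rpow_nonneg (sub_nonneg.2 hu.2.le) _))
    (by have := ProbabilityTheory.beta_pos hkb hν; positivity)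
    (lintegral_rpow_mul_sub_rpow hkb hν ht)
  have e : EqOn (fun s ↦ volterraKernel ν b t s * (mlCoeff ν b k * (s ^ ν) ^ k))
      (fun s ↦ t ^ (1 - b) * mlCoeff ν b k * (s ^ (k * ν + b - 1) * (t - s) ^ (ν - 1)))
      (Ioo 0 t) := by
    intro s hs
    have : s ^ (k * ν + b - 1) = (s ^ ν) ^ k * s ^ (b - 1) := by
      rw [← Real.rpow_mul_natCast hs.1.le, ← Real.rpow_add hs.1]
      ring_nf
    simp only [this, volterraKernel]
    ring
  refine ⟨IntegrableOn.congr_fun (h0.1.const_mul _) e.symm measurableSet_Ioo, ?_⟩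
  rw [setIntegral_congr_fun measurableSet_Ioo e, integral_const_mul, h0.2,
    ← mlCoeff_mul_beta hν hb, ← Real.rpow_mul_natCast ht.le]
  have : t ^ (ν * ((k + 1 : ℕ) : ℝ)) = t ^ (1 - b) * t ^ (k * ν + b + ν - 1) := by
    rw [← Real.rpow_add ht]
    push_cast
    ring_nf
  rw [this]
  ring

theorem integrableOn_volterraKernel {ν b t : ℝ} (hν : 0 < ν) (hb : 0 < b) (ht : 0 < t) :
    IntegrableOn (volterraKernel ν b t) (Icc 0 t) := by
  rw [integrableOn_Icc_iff_integrableOn_Ioo]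
  simpa [mlCoeff_zero hb] using (integral_volterraKernel_mul hν hb ht 0).1

theorem mlSeries_eq_one_add_integral {ν b t : ℝ} (hν : ν ∈ Ioo (0 : ℝ) 1) (hb : 0 < b)
    (ht : 0 < t) (d : ℝ) :
    mlSeries ν b (d * t ^ ν) =
      1 + d * ∫ s in Ioo 0 t, volterraKernel ν b t s * mlSeries ν b (d * s ^ ν) := by
  have h (k : ℕ) := integral_volterraKernel_mul hν.1 hb ht k
  have e (k : ℕ) (s : ℝ) : volterraKernel ν b t s * (mlCoeff ν b k * (d * s ^ ν) ^ k) =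
      d ^ k * (volterraKernel ν b t s * (mlCoeff ν b k * (s ^ ν) ^ k)) := by
    rw [mul_pow]
    ring
  have hs := hasSum_integral_of_summable_integral_norm (μ := volume.restrict (Ioo 0 t))
    (F := fun k s ↦ volterraKernel ν b t s * (mlCoeff ν b k * (d * s ^ ν) ^ k))
    (fun k ↦ by simp_rw [e]; exact (h k).1.const_mul _) ?_
  · simp_rw [tsum_mul_left] at hs
    have hs' := hs.tsum_eq
    simp_rw [mlSeries, ← hs', e, integral_const_mul, (h _).2]
    rw [← tsum_mul_left]
    refine (mlSeries_eq_one_add hν hb _).trans ?_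
    congr 2 with k
    rw [mul_pow]
    ring
  · have hsum := (summable_nat_add_iff 1).2 (summable_mlCoeff hν hb (|d| * t ^ ν))
    have hn (k : ℕ) : ∫ s in Ioo 0 t,
        ‖volterraKernel ν b t s * (mlCoeff ν b k * (d * s ^ ν) ^ k)‖ =
        |d| ^ k * (mlCoeff ν b (k + 1) * (t ^ ν) ^ (k + 1)) := by
      rw [← (h k).2, ← integral_const_mul]
      refine setIntegral_congr_fun measurableSet_Ioo fun s hs ↦ ?_
      have h1 : 0 ≤ volterraKernel ν b t s := volterraKernel_nonneg hs.1.le hs.2.le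
      have h2 := (mlCoeff_pos hν.1 hb k).le
      have h3 : 0 ≤ s ^ ν := Real.rpow_nonneg hs.1.le _
      simp only [e]
      rw [norm_mul, norm_pow, Real.norm_eq_abs, Real.norm_of_nonneg (by positivity)]
    simp_rw [hn]
    rcases eq_or_ne d 0 with rfl | hd
    · exact summable_of_ne_finset_zero (s := {0}) fun k hk ↦ by
        simp [show k ≠ 0 by simpa using hk]
    · refine (hsum.mul_left |d|⁻¹).congr fun k ↦ ?_
      have : |d| ≠ 0 := abs_ne_zero.2 hd
      rw [mul_pow, pow_succ |d|]
      field_simp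

theorem mlSeries_pos {ν b : ℝ} (hν : ν ∈ Ioo (0 : ℝ) 1) (hb : ν ≤ b) (d : ℝ) {t : ℝ}
    (ht : 0 ≤ t) : 0 < mlSeries ν b (d * t ^ ν) := by
  have hb0 : 0 < b := hν.1.trans_le hb
  rcases le_or_gt 0 d with hd | hd
  · rw [mlSeries_eq_one_add hν hb0]
    have := fun k ↦ (mlCoeff_pos hν.1 hb0 k).le
    have : 0 ≤ ∑' k, mlCoeff ν b (k + 1) * (d * t ^ ν) ^ (k + 1) :=
      tsum_nonneg fun k ↦ mul_nonneg (this _) (by positivity)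
    linarith
  set f : ℝ → ℝ := fun s ↦ mlSeries ν b (d * s ^ ν) with hf
  have hfc : Continuous f := (continuous_mlSeries hν hb0).comp
    (continuous_const.mul (Real.continuous_rpow_const hν.1.le))
  by_contra! hneg
  set S : Set ℝ := {s | 0 ≤ s ∧ f s ≤ 0}
  have hSc : IsClosed S := (isClosed_le continuous_const continuous_id).inter
    (isClosed_le hfc continuous_const)
  have hSb : BddBelow S := ⟨0, fun s hs ↦ hs.1⟩
  have hT : sInf S ∈ S := hSc.csInf_mem ⟨t, ht, hneg⟩ hSb
  set T := sInf S
  have hpos : ∀ s, 0 ≤ s → s < T → 0 < f s := fun s hs hsT ↦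
    not_le.1 fun h ↦ (csInf_le hSb ⟨hs, h⟩).not_gt hsT
  have hT0 : 0 < T := by
    refine hT.1.lt_of_ne fun h ↦ ?_
    have h0 : f 0 = 1 := by
      simp [hf, mlSeries_eq_one_add hν hb0, Real.zero_rpow hν.1.ne']
    have := hT.2
    rw [← h, h0] at this
    linarith
  have hfT := mlSeries_eq_one_add_integral hν hb0 hT0 d
  have hKT := integrableOn_volterraKernel hν.1 hb0 hT0
  -- close to `T` the kernel has little mass
  obtain ⟨t₁, ⟨ht₁0, ht₁T⟩, ht₁⟩ : ∃ t₁ ∈ Ioo 0 T,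
      -d * ∫ s in t₁..T, volterraKernel ν b T s < 1 := by
    have hcont := intervalIntegral.continuousOn_primitive_interval_left (a := 0) (b := T)
      (f := volterraKernel ν b T) (μ := volume) (by rwa [uIcc_of_le hT0.le])
    rw [uIcc_of_le hT0.le] at hcont
    have h1 := ((hcont T (right_mem_Icc.2 hT0.le)).mono Ioo_subset_Icc_self).const_mul (-d)
    rw [ContinuousWithinAt, intervalIntegral.integral_same, mul_zero,
      nhdsWithin_Ioo_eq_nhdsLT hT0] at h1
    obtain ⟨x, hx, hx'⟩ := ((h1.eventually_lt_const one_pos).and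
      (Ioo_mem_nhdsLT hT0)).exists
    exact ⟨x, hx', hx⟩
  obtain ⟨τ, hτ, hmax⟩ := isCompact_Icc.exists_isMaxOn (nonempty_Icc.2 ht₁T.le)
    hfc.continuousOn (s := Icc t₁ T)
  have hfτ : 0 < f τ := (hpos t₁ ht₁0.le ht₁T).trans_le (hmax (left_mem_Icc.2 ht₁T.le))
  have hτT : τ < T := hτ.2.lt_of_ne fun h ↦ (h ▸ hfτ).not_ge hT.2
  have hτ0 : 0 < τ := ht₁0.trans_le hτ.1
  have hfτ' := mlSeries_eq_one_add_integral hν hb0 hτ0 d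
  have hKfT : IntegrableOn (fun s ↦ volterraKernel ν b T s * f s) (Icc 0 T) :=
    hKT.mul_continuousOn hfc.continuousOn isCompact_Icc
  have hKfτ : IntegrableOn (fun s ↦ volterraKernel ν b τ s * f s) (Icc 0 τ) :=
    (integrableOn_volterraKernel hν.1 hb0 hτ0).mul_continuousOn hfc.continuousOn isCompact_Icc
  have hsplit : ∫ s in Ioo 0 T, volterraKernel ν b T s * f s =
      (∫ s in Ioo 0 τ, volterraKernel ν b T s * f s) +
        ∫ s in Ico τ T, volterraKernel ν b T s * f s := by
    rw [← Ioo_union_Ico_eq_Ioo hτ0 hτT.le]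
    refine setIntegral_union ?_ measurableSet_Ico
      (hKfT.mono_set fun s hs ↦ ⟨hs.1.le, (hs.2.trans hτT).le⟩)
      (hKfT.mono_set fun s hs ↦ ⟨hτ0.le.trans hs.1, hs.2.le⟩)
    exact disjoint_left.2 fun s hs hs' ↦ hs'.1.not_gt hs.2
  have hleft : ∫ s in Ioo 0 τ, volterraKernel ν b T s * f s ≤
      ∫ s in Ioo 0 τ, volterraKernel ν b τ s * f s := by
    refine setIntegral_mono_on (hKfT.mono_set fun s hs ↦ ⟨hs.1.le, (hs.2.trans hτT).le⟩)
      (hKfτ.mono_set Ioo_subset_Icc_self) measurableSet_Ioo fun s hs ↦ ?_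
    exact mul_le_mul_of_nonneg_right (volterraKernel_anti hν.2.le hb hs.1 hs.2 hτT.le)
      (hpos s hs.1.le (hs.2.trans hτT)).le
  have hright : ∫ s in Ico τ T, volterraKernel ν b T s * f s ≤
      (∫ s in Ico τ T, volterraKernel ν b T s) * f τ := by
    rw [← integral_mul_const]
    refine setIntegral_mono_on (hKfT.mono_set fun s hs ↦ ⟨hτ0.le.trans hs.1, hs.2.le⟩)
      ((hKT.mono_set fun s hs ↦ ⟨hτ0.le.trans hs.1, hs.2.le⟩).mul_const _)
      measurableSet_Ico fun s hs ↦ ?_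
    exact mul_le_mul_of_nonneg_left (hmax ⟨hτ.1.trans hs.1, hs.2.le⟩)
      (volterraKernel_nonneg (hτ0.le.trans hs.1) hs.2.le)
  have hmass : ∫ s in Ico τ T, volterraKernel ν b T s ≤
      ∫ s in t₁..T, volterraKernel ν b T s := by
    rw [intervalIntegral.integral_of_le ht₁T.le, integral_Ioc_eq_integral_Ioo,
      ← integral_Ico_eq_integral_Ioo]
    refine setIntegral_mono_set (hKT.mono_set fun s hs ↦ ⟨ht₁0.le.trans hs.1, hs.2.le⟩) ?_
      (Ico_subset_Ico_left hτ.1).eventuallyLE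
    exact ae_restrict_of_forall_mem measurableSet_Ico fun s hs ↦
      volterraKernel_nonneg (ht₁0.le.trans hs.1) hs.2.le
  have hfT0 : 1 + d * ∫ s in Ioo 0 T, volterraKernel ν b T s * f s ≤ 0 := hfT ▸ hT.2
  have hfτ'' : f τ = 1 + d * ∫ s in Ioo 0 τ, volterraKernel ν b τ s * f s := hfτ'
  have hd' : 0 < -d := neg_pos.2 hd
  have a1 := mul_le_mul_of_nonneg_left hleft hd'.le
  have a2 := mul_le_mul_of_nonneg_left
    (hright.trans (mul_le_mul_of_nonneg_right hmass hfτ.le)) hd'.le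
  have a3 := mul_lt_mul_of_pos_right ht₁ hfτ
  rw [hsplit] at hfT0
  linarith

/-- The simplex integral weighted by a power of the distance from the last point to `t`. -/
theorem lintegral_simplex_mul_sub_rpow {ν b t : ℝ} (hν : 0 < ν) (hb : 0 < b) (ht : 0 < t)
    (k : ℕ) :
    ∫⁻ v : Fin (k + 1) → ℝ,
      {v : Fin (k + 1) → ℝ | StrictMono v ∧ 0 < v 0 ∧ v (Fin.last k) < t}.indicator
        (fun v ↦ ENNReal.ofReal (∏ i, gapR v i ^ (ν - 1)) *
          ENNReal.ofReal (t ^ (1 - b) * (t - v (Fin.last k)) ^ (b - 1))) v =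
      ENNReal.ofReal (mlCoeff ν b (k + 1) * (t ^ ν) ^ (k + 1)) := by
  have hk : 0 < (k + 1) * ν := by positivity
  have hG := Real.Gamma_pos_of_pos hν
  have hGk := Real.Gamma_pos_of_pos hk
  have h := lintegral_simplex hν k (g := (Iio t).indicator fun s ↦
    ENNReal.ofReal (t ^ (1 - b) * (t - s) ^ (b - 1)))
    (Measurable.indicator (by fun_prop) measurableSet_Iio)
  have e : ∀ v : Fin (k + 1) → ℝ,
      {v : Fin (k + 1) → ℝ | StrictMono v ∧ 0 < v 0 ∧ v (Fin.last k) < t}.indicator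
        (fun v ↦ ENNReal.ofReal (∏ i, gapR v i ^ (ν - 1)) *
          ENNReal.ofReal (t ^ (1 - b) * (t - v (Fin.last k)) ^ (b - 1))) v =
      {v : Fin (k + 1) → ℝ | StrictMono v ∧ 0 < v 0}.indicator
        (fun v ↦ ENNReal.ofReal (∏ i, gapR v i ^ (ν - 1)) * (Iio t).indicator (fun s ↦
          ENNReal.ofReal (t ^ (1 - b) * (t - s) ^ (b - 1))) (v (Fin.last k))) v := by
    intro v
    simp only [indicator, mem_ofPred_eq, mem_Iio]
    split_ifs <;> simp_all
  rw [lintegral_congr e, h]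
  set C := Real.Gamma ν ^ (k + 1) / Real.Gamma ((k + 1) * ν) with hC
  have e2 : ∫⁻ s in Ioi 0, ENNReal.ofReal (C * s ^ ((k + 1) * ν - 1)) *
      (Iio t).indicator (fun s ↦ ENNReal.ofReal (t ^ (1 - b) * (t - s) ^ (b - 1))) s =
      ∫⁻ s in Ioo 0 t, ENNReal.ofReal (C * t ^ (1 - b)) *
        ENNReal.ofReal (s ^ ((k + 1) * ν - 1) * (t - s) ^ (b - 1)) := by
    rw [← lintegral_indicator measurableSet_Ioi, ← lintegral_indicator measurableSet_Ioo]
    refine lintegral_congr fun s ↦ ?_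
    by_cases hs : 0 < s
    · by_cases hst : s < t
      · rw [indicator_of_mem (mem_Ioi.2 hs), indicator_of_mem (mem_Iio.2 hst),
          indicator_of_mem (mem_Ioo.2 ⟨hs, hst⟩), ← ENNReal.ofReal_mul (by positivity),
          ← ENNReal.ofReal_mul (by positivity)]
        ring_nf
      · rw [indicator_of_mem (mem_Ioi.2 hs), indicator_of_notMem (by simpa using hst), mul_zero,
          indicator_of_notMem fun h ↦ hst h.2]
    · rw [indicator_of_notMem (by simpa using hs), indicator_of_notMem fun h ↦ hs h.1]
  rw [e2, lintegral_const_mul _ (by fun_prop), lintegral_rpow_mul_sub_rpow hk hb ht,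
    ← ENNReal.ofReal_mul (by positivity), mlCoeff, ProbabilityTheory.beta,
    ← Real.rpow_mul_natCast ht.le]
  have : t ^ (ν * ((k + 1 : ℕ) : ℝ)) = t ^ (1 - b) * t ^ ((k + 1) * ν + b - 1) := by
    rw [← Real.rpow_add ht]
    push_cast
    ring_nf
  rw [this, hC]
  push_cast
  congr 1
  field_simp

theorem simplex_at_zero_eq_empty (k : ℕ) :
    {v : Fin (k + 1) → ℝ | StrictMono v ∧ 0 < v 0 ∧ v (Fin.last k) < 0} = ∅ := by
  ext v
  simp only [mem_ofPred_eq, mem_empty_iff_false, iff_false]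
  rintro ⟨h1, h2, h3⟩
  exact (h2.trans_le (h1.monotone (Fin.zero_le _))).not_gt h3

theorem simplexIntLFree_eq {ν t : ℝ} (hν : 0 < ν) (ht : 0 ≤ t) (k : ℕ) :
    simplexIntLFree ν t k = ENNReal.ofReal (mlCoeff ν 1 (k + 1) * (t ^ ν) ^ (k + 1)) := by
  rcases ht.eq_or_lt with rfl | ht
  · simp [simplexIntLFree, simplex_at_zero_eq_empty, Real.zero_rpow hν.ne']
  · rw [← lintegral_simplex_mul_sub_rpow hν one_pos ht]
    simp [simplexIntLFree]

theorem simplexIntLCons_eq {ν t : ℝ} (hν : 0 < ν) (ht : 0 ≤ t) (k : ℕ) :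
    simplexIntLCons ν t k = ENNReal.ofReal (mlCoeff ν ν (k + 1) * (t ^ ν) ^ (k + 1)) := by
  rcases ht.eq_or_lt with rfl | ht
  · simp [simplexIntLCons, simplex_at_zero_eq_empty, Real.zero_rpow hν.ne']
  · rw [← lintegral_simplex_mul_sub_rpow hν hν ht, simplexIntLCons]
    refine lintegral_congr fun v ↦ ?_
    by_cases hv : v ∈ {v : Fin (k + 1) → ℝ | StrictMono v ∧ 0 < v 0 ∧ v (Fin.last k) < t}
    · have : 0 ≤ t - v (Fin.last k) := sub_nonneg.2 hv.2.2.le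
      rw [indicator_of_mem hv, indicator_of_mem hv, neg_sub, ENNReal.ofReal_mul (by positivity),
        mul_comm]
    · rw [indicator_of_notMem hv, indicator_of_notMem hv]

/-- For `ν ∈ (0,1)` and `δ̂ ∈ ℝ`, the series defining `Ψ̂^ν_δ̂(t)` and
`Ψ̂^{ν,c}_δ̂(t)` converge absolutely (all the simplex integrals being finite) for every
`t ≥ 0`, the functions `t ↦ Ψ̂^ν_δ̂(t)`, `t ↦ Ψ̂^{ν,c}_δ̂(t)` are continuous on `[0,∞)`,
and both are strictly positive there. -/
theorem stmt_6 (ν : ℝ) (hν : ν ∈ Set.Ioo (0:ℝ) 1) (dh : ℝ) :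
    (∀ t : ℝ, 0 ≤ t →
      (∀ k : ℕ, simplexIntLFree ν t k ≠ ⊤) ∧
      (∀ k : ℕ, simplexIntLCons ν t k ≠ ⊤) ∧
      Summable (fun k : ℕ => |dh ^ (k + 1) * simplexIntFree ν t k|) ∧
      Summable (fun k : ℕ => |dh ^ (k + 1) * simplexIntCons ν t k|))
    ∧ ContinuousOn (fun t => PsiHatFree ν dh t) (Set.Ici 0)
    ∧ ContinuousOn (fun t => PsiHatCons ν dh t) (Set.Ici 0)
    ∧ (∀ t : ℝ, 0 ≤ t → 0 < PsiHatFree ν dh t ∧ 0 < PsiHatCons ν dh t) := by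
  obtain ⟨hν0, hν1⟩ := hν
  have hν : ν ∈ Ioo (0 : ℝ) 1 := ⟨hν0, hν1⟩
  have hF : ∀ t : ℝ, 0 ≤ t → ∀ k, dh ^ (k + 1) * simplexIntFree ν t k =
      mlCoeff ν 1 (k + 1) * (dh * t ^ ν) ^ (k + 1) := fun t ht k ↦ by
    have := (mlCoeff_pos hν0 one_pos (k + 1)).le
    rw [simplexIntFree, simplexIntLFree_eq hν0 ht, ENNReal.toReal_ofReal (by positivity), mul_pow]
    ring
  have hC : ∀ t : ℝ, 0 ≤ t → ∀ k, dh ^ (k + 1) * simplexIntCons ν t k =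
      mlCoeff ν ν (k + 1) * (dh * t ^ ν) ^ (k + 1) := fun t ht k ↦ by
    have := (mlCoeff_pos hν0 hν0 (k + 1)).le
    rw [simplexIntCons, simplexIntLCons_eq hν0 ht, ENNReal.toReal_ofReal (by positivity), mul_pow]
    ring
  have hPF : ∀ t : ℝ, 0 ≤ t → PsiHatFree ν dh t = mlSeries ν 1 (dh * t ^ ν) := fun t ht ↦ by
    rw [PsiHatFree, mlSeries_eq_one_add hν one_pos, tsum_congr (hF t ht)]
  have hPC : ∀ t : ℝ, 0 ≤ t → PsiHatCons ν dh t = mlSeries ν ν (dh * t ^ ν) := fun t ht ↦ by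
    rw [PsiHatCons, mlSeries_eq_one_add hν hν0, tsum_congr (hC t ht)]
  have hcont : Continuous fun t : ℝ ↦ dh * t ^ ν :=
    continuous_const.mul (Real.continuous_rpow_const hν0.le)
  refine ⟨fun t ht ↦ ⟨fun k ↦ ?_, fun k ↦ ?_, ?_, ?_⟩, ?_, ?_, fun t ht ↦ ⟨?_, ?_⟩⟩
  · exact simplexIntLFree_eq hν0 ht k ▸ ENNReal.ofReal_ne_top
  · exact simplexIntLCons_eq hν0 ht k ▸ ENNReal.ofReal_ne_top
  · simp_rw [hF t ht]
    exact ((summable_nat_add_iff 1).2 (summable_mlCoeff hν one_pos _)).abs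
  · simp_rw [hC t ht]
    exact ((summable_nat_add_iff 1).2 (summable_mlCoeff hν hν0 _)).abs
  · exact ((continuous_mlSeries hν one_pos).comp hcont).continuousOn.congr hPF
  · exact ((continuous_mlSeries hν hν0).comp hcont).continuousOn.congr hPC
  · exact hPF t ht ▸ mlSeries_pos hν hν1.le dh ht
  · exact hPC t ht ▸ mlSeries_pos hν le_rfl dh ht
end

section
/- For every α ∈ (0,1) there exists a constant c_α ∈ (0,∞) such that for every integer n ≥ 2, every γ ∈ (0, 1/4) and every y ∈ [0,1]: ∫∫_{{(z,w) : n−1 ≤ z ≤ w ≤ n, w − z ≤ γ}} (1 − y)^α (z − y)^{−(1+α)} (w − z)^{−(1−α)} (n − w)^{−α} dz dw ≤ c_α γ^{α} n^{−(1+α)}. -/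
open MeasureTheory

lemma integrable_indicator_Icc_and_integral_eq {f : ℝ → ℝ} {a b : ℝ} (hab : a ≤ b)
    (hf : IntervalIntegrable f volume a b) :
    Integrable ((Set.Icc a b).indicator f) ∧
      ∫ x, (Set.Icc a b).indicator f x = ∫ x in a..b, f x := by
  constructor
  · rw [integrable_indicator_iff measurableSet_Icc]
    exact (intervalIntegrable_iff_integrableOn_Icc_of_le hab).1 hf
  · rw [integral_indicator measurableSet_Icc, intervalIntegral.integral_of_le hab,
      integral_Icc_eq_integral_Ioc]

lemma integrable_mul_comp_sub_left_and_integral_eq {f k : ℝ → ℝ} (hf : Integrable f)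
    (hk : Integrable k) :
    Integrable (fun p : ℝ × ℝ ↦ f p.1 * k (p.2 - p.1)) ∧
      ∫ p : ℝ × ℝ, f p.1 * k (p.2 - p.1) = (∫ x, f x) * ∫ x, k x := by
  have hmp := measurePreserving_prod_sub (volume : Measure ℝ) (volume : Measure ℝ)
  have hint : Integrable (fun p : ℝ × ℝ ↦ f p.1 * k p.2)
      ((volume : Measure ℝ).prod (volume : Measure ℝ)) := hf.mul_prod hk
  have hEq : (fun p : ℝ × ℝ ↦ f p.1 * k (p.2 - p.1)) =
      (fun p : ℝ × ℝ ↦ f p.1 * k p.2) ∘ fun z : ℝ × ℝ ↦ (z.1, z.2 - z.1) := rfl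
  constructor
  · rw [hEq]
    exact hmp.integrable_comp_of_integrable hint
  · rw [hEq, ← integral_prod_mul, ← hmp.map_eq, integral_map hmp.measurable.aemeasurable]
    · rfl
    · rw [hmp.map_eq]
      exact hint.aestronglyMeasurable

lemma integrable_mul_comp_sub_right_and_integral_eq {f k : ℝ → ℝ} (hf : Integrable f)
    (hk : Integrable k) :
    Integrable (fun p : ℝ × ℝ ↦ f p.2 * k (p.2 - p.1)) ∧
      ∫ p : ℝ × ℝ, f p.2 * k (p.2 - p.1) = (∫ x, f x) * ∫ x, k x := by
  obtain ⟨h₁, h₂⟩ := integrable_mul_comp_sub_left_and_integral_eq hf hk.comp_neg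
  have hEq : (fun p : ℝ × ℝ ↦ f p.2 * k (p.2 - p.1)) =
      (fun p : ℝ × ℝ ↦ f p.1 * k (-(p.2 - p.1))) ∘ Prod.swap := by
    ext p
    simp
  constructor
  · rw [hEq]
    exact h₁.swap
  · rw [hEq, ← integral_neg_eq_self k, ← h₂]
    exact integral_prod_swap (μ := (volume : Measure ℝ)) (ν := (volume : Measure ℝ))
      (fun p : ℝ × ℝ ↦ f p.1 * k (-(p.2 - p.1)))

lemma regenerative_kernel_bound_near_left {α n y z : ℝ} (hα : 0 < α) (hn : 2 ≤ n) (hy0 : 0 ≤ y)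
    (hy1 : y < 1) (hz : n - 1 ≤ z) (hzn : z ≤ n) :
    (z - y) ^ (-(1 + α)) ≤ 2 ^ (1 + α) * n ^ (-(1 + α)) * (z - (n - 2 + y)) ^ (-(1 + α)) := by
  have hu : 0 < z - (n - 2 + y) := by linarith
  have h : n / 2 * (z - (n - 2 + y)) ≤ z - y := by nlinarith
  calc (z - y) ^ (-(1 + α)) ≤ (n / 2 * (z - (n - 2 + y))) ^ (-(1 + α)) :=
        Real.rpow_le_rpow_of_nonpos (by positivity) h (by linarith)
    _ = _ := by
        rw [Real.mul_rpow (by positivity) hu.le, Real.div_rpow (by positivity) (by norm_num),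
          Real.rpow_neg (by norm_num : (0:ℝ) ≤ 2), div_inv_eq_mul]
        ring

lemma regenerative_kernel_bound_near_right {α n y z : ℝ} (hα : 0 < α) (hn : 2 ≤ n)
    (hy1 : y ≤ 1) (hz : n - 1 / 2 ≤ z) :
    (z - y) ^ (-(1 + α)) ≤ 4 ^ (1 + α) * n ^ (-(1 + α)) := by
  calc (z - y) ^ (-(1 + α)) ≤ (n / 4) ^ (-(1 + α)) :=
        Real.rpow_le_rpow_of_nonpos (by positivity) (by linarith) (by linarith)
    _ = _ := by
        rw [Real.div_rpow (by positivity) (by norm_num),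
          Real.rpow_neg (by norm_num : (0:ℝ) ≤ 4), div_inv_eq_mul]
        ring

lemma integral_rpow_sub_le {α a y : ℝ} (hα : 0 < α) (hy1 : y < 1) :
    IntervalIntegrable (fun z ↦ (z - (a - 2 + y)) ^ (-(1 + α))) volume (a - 1) a ∧
      ∫ z in (a - 1)..a, (z - (a - 2 + y)) ^ (-(1 + α)) ≤ (1 - y) ^ (-α) / α := by
  constructor
  · apply ContinuousOn.intervalIntegrable
    intro z hz
    rw [Set.uIcc_of_le (by linarith)] at hz
    have : z - (a - 2 + y) ≠ 0 := by linarith [hz.1] |> ne_of_gt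
    exact ((continuousAt_id.sub continuousAt_const).rpow_const (Or.inl this)).continuousWithinAt
  · rw [intervalIntegral.integral_comp_sub_right (fun s ↦ s ^ (-(1 + α))),
      integral_rpow (Or.inr ⟨by linarith, by
        rw [Set.uIcc_of_le (by linarith)]
        intro h
        linarith [h.1]⟩)]
    have e : -(1 + α) + 1 = -α := by ring
    have e₂ : a - 1 - (a - 2 + y) = 1 - y := by ring
    have e₃ : a - (a - 2 + y) = 2 - y := by ring
    rw [e, e₂, e₃, div_neg, ← neg_div, neg_sub]
    have : 0 ≤ (2 - y) ^ (-α) := Real.rpow_nonneg (by linarith) _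
    gcongr
    linarith

lemma integral_rpow_sub_left {α a : ℝ} (hα : α < 1) :
    IntervalIntegrable (fun w ↦ (a - w) ^ (-α)) volume (a - 1) a ∧
      ∫ w in (a - 1)..a, (a - w) ^ (-α) = 1 / (1 - α) := by
  constructor
  · have h : IntervalIntegrable (fun s : ℝ ↦ s ^ (-α)) volume 1 0 :=
      intervalIntegral.intervalIntegrable_rpow' (by linarith)
    simpa using h.comp_sub_left a
  · rw [intervalIntegral.integral_comp_sub_left (fun s ↦ s ^ (-α)),
      integral_rpow (Or.inl (by linarith))]
    have e : -α + 1 = 1 - α := by ring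
    rw [e, sub_self, sub_sub_cancel, Real.one_rpow, Real.zero_rpow (by linarith), sub_zero]

/-- For every `α ∈ (0,1)` there is `c_α < ∞` such that for all integers
`n ≥ 2`, all `γ ∈ (0,1/4)` and all `y ∈ [0,1]`, the integral of
`(1-y)^α (z-y)^{-(1+α)} (w-z)^{-(1-α)} (n-w)^{-α}` over the region
`{(z,w) : n-1 ≤ z ≤ w ≤ n, w - z ≤ γ}` is at most `c_α γ^α n^{-(1+α)}`. -/
theorem stmt_11 (α : ℝ) (hα : α ∈ Set.Ioo (0:ℝ) 1) :
    ∃ c : ℝ, 0 < c ∧ ∀ n : ℕ, 2 ≤ n → ∀ γ : ℝ, γ ∈ Set.Ioo (0:ℝ) (1/4) →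
      ∀ y : ℝ, y ∈ Set.Icc (0:ℝ) 1 →
        (∫ p in {p : ℝ × ℝ | (n:ℝ) - 1 ≤ p.1 ∧ p.1 ≤ p.2 ∧ p.2 ≤ (n:ℝ) ∧ p.2 - p.1 ≤ γ},
            (1 - y) ^ α * (p.1 - y) ^ (-(1 + α)) * (p.2 - p.1) ^ (-(1 - α))
              * ((n:ℝ) - p.2) ^ (-α))
          ≤ c * γ ^ α * (n:ℝ) ^ (-(1 + α)) := by
  obtain ⟨hα0, hα1⟩ := hα
  have h1α : 0 < 1 - α := by linarith
  refine ⟨4 ^ α * 2 ^ (1 + α) / α / α + 4 ^ (1 + α) / (1 - α) / α, by positivity, ?_⟩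
  rintro n hn γ ⟨hγ0, hγ1⟩ y ⟨hy0, hy1⟩
  have hn2 : (2:ℝ) ≤ n := by exact_mod_cast hn
  have hN : 0 ≤ (n:ℝ) ^ (-(1 + α)) := by positivity
  generalize (n:ℝ) = N at hn2 hN ⊢
  rcases hy1.eq_or_lt with rfl | hy1
  · simp only [sub_self, Real.zero_rpow hα0.ne', zero_mul, integral_zero]
    positivity
  have h1y : 0 < 1 - y := by linarith
  set f : ℝ → ℝ := (Set.Icc (N - 1) N).indicator fun z ↦ (z - (N - 2 + y)) ^ (-(1 + α)) with hf
  set b : ℝ → ℝ := (Set.Icc (N - 1) N).indicator fun w ↦ (N - w) ^ (-α) with hb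
  set k : ℝ → ℝ := (Set.Icc 0 γ).indicator fun s ↦ s ^ (-(1 - α)) with hk
  have hf0 : ∀ x, 0 ≤ f x := Set.indicator_nonneg fun x hx ↦ by
    exact Real.rpow_nonneg (by linarith [hx.1]) _
  have hb0 : ∀ x, 0 ≤ b x := Set.indicator_nonneg fun x hx ↦ by
    exact Real.rpow_nonneg (by linarith [hx.2]) _
  have hk0 : ∀ x, 0 ≤ k x := Set.indicator_nonneg fun x hx ↦ by
    exact Real.rpow_nonneg hx.1 _
  obtain ⟨hf_int, hf_eq⟩ := integrable_indicator_Icc_and_integral_eq (by linarith)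
    (integral_rpow_sub_le (a := N) hα0 hy1).1
  have hf_le := hf_eq.trans_le (integral_rpow_sub_le hα0 hy1).2
  obtain ⟨hb_int, hb_eq⟩ := integrable_indicator_Icc_and_integral_eq (by linarith)
    (integral_rpow_sub_left (a := N) hα1).1
  rw [(integral_rpow_sub_left hα1).2] at hb_eq
  obtain ⟨hk_int, hk_eq⟩ := integrable_indicator_Icc_and_integral_eq hγ0.le
    (intervalIntegral.intervalIntegrable_rpow' (a := 0) (b := γ) (r := -(1 - α)) (by linarith))
  rw [integral_rpow (Or.inl (by linarith)), show -(1 - α) + 1 = α by ring,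
    Real.zero_rpow hα0.ne', sub_zero] at hk_eq
  rw [← hf] at hf_int hf_le
  rw [← hb] at hb_int hb_eq
  rw [← hk] at hk_int hk_eq
  obtain ⟨hfk_int, hfk_eq⟩ := integrable_mul_comp_sub_left_and_integral_eq hf_int hk_int
  obtain ⟨hbk_int, hbk_eq⟩ := integrable_mul_comp_sub_right_and_integral_eq hb_int hk_int
  set A : ℝ := 4 ^ α * 2 ^ (1 + α) * N ^ (-(1 + α)) * (1 - y) ^ α with hA
  set B : ℝ := 4 ^ (1 + α) * N ^ (-(1 + α)) with hB
  have hA0 : 0 ≤ A := by positivity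
  have hB0 : 0 ≤ B := by positivity
  set S : Set (ℝ × ℝ) := {p | N - 1 ≤ p.1 ∧ p.1 ≤ p.2 ∧ p.2 ≤ N ∧ p.2 - p.1 ≤ γ} with hS
  have hSm : MeasurableSet S := by
    have : IsClosed S := by
      simp only [hS, Set.ofPred_and]
      exact (isClosed_le (by fun_prop) (by fun_prop)).inter
        ((isClosed_le (by fun_prop) (by fun_prop)).inter
        ((isClosed_le (by fun_prop) (by fun_prop)).inter
        (isClosed_le (by fun_prop) (by fun_prop))))
    exact this.measurableSet
  have hg_int := (hfk_int.const_mul A).add (hbk_int.const_mul B)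
  have hfk0 : ∀ p : ℝ × ℝ, 0 ≤ A * (f p.1 * k (p.2 - p.1)) := fun p ↦
    mul_nonneg hA0 (mul_nonneg (hf0 _) (hk0 _))
  have hbk0 : ∀ p : ℝ × ℝ, 0 ≤ B * (b p.2 * k (p.2 - p.1)) := fun p ↦
    mul_nonneg hB0 (mul_nonneg (hb0 _) (hk0 _))
  calc
    _ ≤ ∫ p in S, (A * (f p.1 * k (p.2 - p.1)) + B * (b p.2 * k (p.2 - p.1))) := by
      refine integral_mono_of_nonneg (ae_restrict_of_forall_mem hSm ?_) hg_int.integrableOn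
        (ae_restrict_of_forall_mem hSm ?_)
      · rintro ⟨z, w⟩ ⟨h1, h2, h3, h4⟩
        dsimp only at h1 h2 h3 h4
        have := Real.rpow_nonneg (show 0 ≤ z - y by linarith) (-(1 + α))
        have := Real.rpow_nonneg (show 0 ≤ w - z by linarith) (-(1 - α))
        have := Real.rpow_nonneg (show 0 ≤ N - w by linarith) (-α)
        dsimp only [Pi.zero_apply]
        positivity
      · rintro ⟨z, w⟩ ⟨h1, h2, h3, h4⟩
        have hfk0' := hfk0 (z, w)
        have hbk0' := hbk0 (z, w)
        dsimp only at h1 h2 h3 h4 hfk0' hbk0' ⊢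
        have hfz : f z = (z - (N - 2 + y)) ^ (-(1 + α)) :=
          Set.indicator_of_mem (Set.mem_Icc.2 ⟨h1, by linarith⟩) _
        have hbw : b w = (N - w) ^ (-α) :=
          Set.indicator_of_mem (Set.mem_Icc.2 ⟨by linarith, h3⟩) _
        have hkw : k (w - z) = (w - z) ^ (-(1 - α)) :=
          Set.indicator_of_mem (Set.mem_Icc.2 ⟨by linarith, h4⟩) _
        have hk0' := hk0 (w - z)
        have hb0' := hb0 w
        have hf0' := hf0 z
        have hz0 := Real.rpow_nonneg (show 0 ≤ z - y by linarith) (-(1 + α))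
        rw [← hbw, ← hkw]
        rcases le_total z (N - 1 / 2) with hz | hz
        · refine le_trans ?_ (le_add_of_nonneg_right hbk0')
          have hb4 : b w ≤ 4 ^ α := by
            rw [hbw]
            calc (N - w) ^ (-α) ≤ (1 / 4) ^ (-α) :=
                  Real.rpow_le_rpow_of_nonpos (by norm_num) (by linarith) (by linarith)
              _ = 4 ^ α := by
                  rw [one_div, Real.inv_rpow (by norm_num), Real.rpow_neg (by norm_num), inv_inv]
          have hzy := regenerative_kernel_bound_near_left hα0 hn2 hy0 hy1 h1 (h2.trans h3)
          rw [← hfz] at hzy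
          calc (1 - y) ^ α * (z - y) ^ (-(1 + α)) * k (w - z) * b w
              ≤ (1 - y) ^ α * (2 ^ (1 + α) * N ^ (-(1 + α)) * f z) * k (w - z) * 4 ^ α := by
                gcongr
            _ = A * (f z * k (w - z)) := by rw [hA]; ring
        · refine le_trans ?_ (le_add_of_nonneg_left hfk0')
          have hzy := regenerative_kernel_bound_near_right hα0 hn2 hy1.le hz
          calc (1 - y) ^ α * (z - y) ^ (-(1 + α)) * k (w - z) * b w
              ≤ 1 * B * k (w - z) * b w := by
                gcongr
                exact Real.rpow_le_one h1y.le (by linarith) hα0.le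
            _ = B * (b w * k (w - z)) := by ring
    _ ≤ ∫ p : ℝ × ℝ, (A * (f p.1 * k (p.2 - p.1)) + B * (b p.2 * k (p.2 - p.1))) :=
      setIntegral_le_integral hg_int (Filter.Eventually.of_forall fun p ↦
        add_nonneg (hfk0 p) (hbk0 p))
    _ = A * ((∫ x, f x) * (γ ^ α / α)) + B * (1 / (1 - α) * (γ ^ α / α)) := by
      rw [integral_add (hfk_int.const_mul A) (hbk_int.const_mul B), integral_const_mul,
        integral_const_mul, hfk_eq, hbk_eq, hb_eq, hk_eq]
    _ ≤ A * ((1 - y) ^ (-α) / α * (γ ^ α / α)) + B * (1 / (1 - α) * (γ ^ α / α)) := by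
      gcongr
    _ = _ := by
      have hy : (1 - y) ^ α * (1 - y) ^ (-α) = 1 := by
        rw [← Real.rpow_add h1y, add_neg_cancel, Real.rpow_zero]
      calc _ = 4 ^ α * 2 ^ (1 + α) * N ^ (-(1 + α)) * ((1 - y) ^ α * (1 - y) ^ (-α))
              / α * (γ ^ α / α) + B * (1 / (1 - α) * (γ ^ α / α)) := by rw [hA]; ring
        _ = _ := by rw [hy, hB]; ring
end
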